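/- arXiv:2412.10938 — 2 statements merged into one kernel-verified Lean document; each statement's English description precedes it below -/
import Mathlib

section
/- Let q>1 be a real number. There exists a constant Δ = Δ(q) > 0, independent of δ, such that for every δ>0 and every z∈ℂ∖{0} satisfying |1 + z q^m| > δ for all m∈ℤ, one has |Θ_q(z)| ≥ Δ · δ · exp( (1/(2 log q)) · (log|z|)² ) · |z|^{1/2}. -/
set_option autoImplicit false

open Complex Real

/-- The Jacobi Theta function `Θ_q(z) = ∑_{n ∈ ℤ} q^{-n(n-1)/2} z^n`. -/
noncomputable def jacobiThetaQ (q : ℝ) (z : ℂ) : ℂ :=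
  ∑' n : ℤ, z ^ n / (q : ℂ) ^ ((n * (n - 1)) / 2)

open Filter Topology Finset

/-- The finite `q`-Pochhammer product `∏_{k < n} (1 - p^{k+1})`. -/
noncomputable def eulerProd (p : ℝ) (n : ℕ) : ℝ := ∏ k ∈ range n, (1 - p ^ (k + 1))

/-- Gaussian binomial coefficients at the real number `p`, defined by the Pascal-type recursion. -/
noncomputable def gaussBinom (p : ℝ) : ℕ → ℕ → ℝ
  | _, 0 => 1
  | 0, _ + 1 => 0
  | m + 1, j + 1 => p ^ (j + 1) * gaussBinom p m (j + 1) + gaussBinom p m j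

lemma eulerProd_succ (p : ℝ) (n : ℕ) : eulerProd p (n + 1) = eulerProd p n * (1 - p ^ (n + 1)) :=
  prod_range_succ _ _

lemma eulerProd_pos {p : ℝ} (hp0 : 0 < p) (hp1 : p < 1) (n : ℕ) : 0 < eulerProd p n :=
  prod_pos fun k _ => sub_pos.2 (pow_lt_one₀ hp0.le hp1 k.succ_ne_zero)

lemma eulerProd_antitone {p : ℝ} (hp0 : 0 < p) (hp1 : p < 1) : Antitone (eulerProd p) := by
  refine antitone_nat_of_succ_le fun n => ?_
  rw [eulerProd_succ]
  have := eulerProd_pos hp0 hp1 n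
  have : 0 < p ^ (n + 1) := by positivity
  nlinarith

lemma exists_tendsto_eulerProd {p : ℝ} (hp0 : 0 < p) (hp1 : p < 1) :
    ∃ L : ℝ, 0 < L ∧ (∀ n, L ≤ eulerProd p n) ∧ Tendsto (eulerProd p) atTop (𝓝 L) := by
  have hs : Summable fun k : ℕ => ‖-(p ^ (k + 1))‖ := by
    have h := (summable_geometric_of_lt_one hp0.le hp1).mul_left p
    refine h.congr fun k => ?_
    rw [norm_neg, Real.norm_of_nonneg (by positivity)]
    ring
  have hne : ∏' k : ℕ, (1 + -(p ^ (k + 1))) ≠ 0 := by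
    refine tprod_one_add_ne_zero_of_summable (fun k => ?_) hs
    have := pow_lt_one₀ hp0.le hp1 k.succ_ne_zero
    simp only [Nat.succ_eq_add_one] at this
    linarith
  have ht : Tendsto (eulerProd p) atTop (𝓝 (∏' k : ℕ, (1 + -(p ^ (k + 1))))) := by
    refine (multipliable_one_add_of_summable hs).hasProd.tendsto_prod_nat.congr fun n => ?_
    simp [eulerProd, sub_eq_add_neg]
  have hnn : 0 ≤ ∏' k : ℕ, (1 + -(p ^ (k + 1))) :=
    ge_of_tendsto' ht fun n => (eulerProd_pos hp0 hp1 n).le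
  exact ⟨_, lt_of_le_of_ne hnn hne.symm, (eulerProd_antitone hp0 hp1).le_of_tendsto ht, ht⟩

@[simp] lemma gaussBinom_zero_right (p : ℝ) (m : ℕ) : gaussBinom p m 0 = 1 := by
  cases m <;> rfl

lemma gaussBinom_succ_succ (p : ℝ) (m j : ℕ) :
    gaussBinom p (m + 1) (j + 1) = p ^ (j + 1) * gaussBinom p m (j + 1) + gaussBinom p m j := rfl

lemma gaussBinom_eq_zero (p : ℝ) {m j : ℕ} (h : m < j) : gaussBinom p m j = 0 := by
  induction m generalizing j with
  | zero =>
    obtain ⟨j, rfl⟩ := Nat.exists_eq_add_one.2 h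
    rfl
  | succ m ih =>
    obtain ⟨j, rfl⟩ := Nat.exists_eq_add_one.2 (Nat.zero_lt_of_lt h)
    rw [gaussBinom_succ_succ, ih (by omega), ih (by omega)]
    simp

lemma gaussBinom_mul_eulerProd (p : ℝ) {m j k : ℕ} (h : j + k = m) :
    gaussBinom p m j * (eulerProd p j * eulerProd p k) = eulerProd p m := by
  induction m generalizing j k with
  | zero =>
    obtain ⟨rfl, rfl⟩ : j = 0 ∧ k = 0 := by omega
    simp [eulerProd]
  | succ m ih =>
    rcases j with _ | j
    · obtain rfl : k = m + 1 := by omega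
      simp [eulerProd]
    rw [gaussBinom_succ_succ]
    have h1 := ih (j := j) (k := k) (by omega)
    rcases k with _ | k
    · obtain rfl : j = m := by omega
      rw [gaussBinom_eq_zero p (Nat.lt_succ_self j), eulerProd_succ p j]
      linear_combination (1 - p ^ (j + 1)) * h1
    · have h2 := ih (j := j + 1) (k := k) (by omega)
      obtain rfl : m = j + k + 1 := by omega
      rw [eulerProd_succ p (j + k + 1)]
      rw [eulerProd_succ p k] at h1 ⊢
      rw [eulerProd_succ p j] at h2 ⊢
      linear_combination (1 - p ^ (j + 1)) * h1 + p ^ (j + 1) * (1 - p ^ (k + 1)) * h2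

lemma gaussBinom_nonneg {p : ℝ} (hp : 0 ≤ p) (m j : ℕ) : 0 ≤ gaussBinom p m j := by
  induction m generalizing j with
  | zero => cases j <;> simp [gaussBinom]
  | succ m ih =>
    cases j with
    | zero => simp
    | succ j =>
      rw [gaussBinom_succ_succ]
      have := ih (j + 1)
      have := ih j
      positivity

lemma gaussBinom_le {p L : ℝ} (hp0 : 0 < p) (hp1 : p < 1) (hL : 0 < L)
    (hLe : ∀ n, L ≤ eulerProd p n) (m j : ℕ) : gaussBinom p m j ≤ 1 / L ^ 2 := by
  rcases lt_or_ge m j with h | h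
  · rw [gaussBinom_eq_zero p h]
    positivity
  · rw [le_div_iff₀ (by positivity)]
    have h1 := gaussBinom_mul_eulerProd p (Nat.add_sub_of_le h)
    have h2 : eulerProd p m ≤ 1 := by
      simpa [eulerProd] using eulerProd_antitone hp0 hp1 (Nat.zero_le m)
    calc gaussBinom p m j * L ^ 2 = gaussBinom p m j * (L * L) := by ring
      _ ≤ gaussBinom p m j * (eulerProd p j * eulerProd p (m - j)) :=
          mul_le_mul_of_nonneg_left
            (mul_le_mul (hLe _) (hLe _) hL.le (eulerProd_pos hp0 hp1 _).le)
            (gaussBinom_nonneg hp0.le m j)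
      _ ≤ 1 := h1.trans_le h2

/-- The `q`-binomial theorem. -/
lemma prod_one_add_mul_pow (p : ℝ) (m : ℕ) (x : ℂ) :
    ∏ k ∈ range m, (1 + x * (p : ℂ) ^ k) =
      ∑ j ∈ range (m + 1), (gaussBinom p m j : ℂ) * (∏ i ∈ range j, (p : ℂ) ^ i) * x ^ j := by
  induction m generalizing x with
  | zero => simp
  | succ m ih =>
    have h0 : ∏ k ∈ range m, (1 + x * (p : ℂ) ^ (k + 1)) =
        ∏ k ∈ range m, (1 + (x * p) * (p : ℂ) ^ k) :=
      prod_congr rfl fun k _ => by ring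
    have h1 : ∑ j ∈ range (m + 1),
          (gaussBinom p m j : ℂ) * (∏ i ∈ range j, (p : ℂ) ^ i) * (x * p) ^ j =
        ∑ j ∈ range (m + 1), (gaussBinom p m (j + 1) : ℂ) *
          (∏ i ∈ range (j + 1), (p : ℂ) ^ i) * (x * p) ^ (j + 1) + 1 := by
      have h2 := sum_range_succ (fun j => (gaussBinom p m j : ℂ) *
        (∏ i ∈ range j, (p : ℂ) ^ i) * (x * p) ^ j) (m + 1)
      rw [gaussBinom_eq_zero p (Nat.lt_succ_self m)] at h2
      rw [sum_range_succ'] at h2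
      simpa using h2.symm
    rw [prod_range_succ', h0, ih, sum_range_succ' _ (m + 1)]
    simp only [pow_zero, mul_one]
    rw [mul_add, mul_one]
    nth_rewrite 1 [h1]
    rw [sum_mul, add_right_comm, ← sum_add_distrib]
    simp only [gaussBinom_zero_right, prod_range_zero, ofReal_one, mul_one]
    congr 1
    refine sum_congr rfl fun j _ => ?_
    rw [gaussBinom_succ_succ, prod_range_succ]
    push_cast
    ring

lemma thetaTerm_succ {q : ℝ} (hq : q ≠ 0) {z : ℂ} (hz : z ≠ 0) (n : ℤ) :
    z ^ (n + 1) / (q : ℂ) ^ (((n + 1) * (n + 1 - 1)) / 2) =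
      z ^ n / (q : ℂ) ^ ((n * (n - 1)) / 2) * (z / (q : ℂ) ^ n) := by
  have hq' : (q : ℂ) ≠ 0 := by exact_mod_cast hq
  have h : ((n + 1) * (n + 1 - 1)) / 2 = (n * (n - 1)) / 2 + n := by
    rw [show (n + 1) * (n + 1 - 1) = n * (n - 1) + n * 2 by ring,
      Int.add_mul_ediv_right _ _ two_ne_zero]
  rw [h, zpow_add₀ hq', zpow_add_one₀ hz]
  field_simp

lemma two_mul_triangle (n : ℤ) : 2 * ((n * (n - 1)) / 2) = n * (n - 1) :=
  Int.mul_ediv_cancel' (Int.even_mul_pred_self n).two_dvd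

lemma summable_norm_thetaTerm {q : ℝ} (hq : 1 < q) {z : ℂ} (hz : z ≠ 0) :
    Summable fun n : ℤ => ‖z ^ n / (q : ℂ) ^ ((n * (n - 1)) / 2)‖ := by
  have hq0 : 0 < q := by linarith
  have hlog : 0 < Real.log q := Real.log_pos hq
  have hT : 0 < Real.log q / (2 * π) := by positivity
  have hs := summable_pow_mul_jacobiTheta₂_term_bound
    ((|Real.log ‖z‖| + Real.log q / 2) / (2 * π)) hT 0
  refine hs.of_nonneg_of_le (fun _ => norm_nonneg _) fun n => ?_
  have hz0 : 0 < ‖z‖ := norm_pos_iff.2 hz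
  have htri : (((n * (n - 1)) / 2 : ℤ) : ℝ) = (n * (n - 1) : ℝ) / 2 := by
    have h : (2 : ℝ) * (((n * (n - 1)) / 2 : ℤ) : ℝ) = n * (n - 1) := by
      exact_mod_cast two_mul_triangle n
    linarith
  rw [norm_div, norm_zpow, norm_zpow, norm_real, Real.norm_of_nonneg hq0.le,
    ← Real.rpow_intCast, ← Real.rpow_intCast, Real.rpow_def_of_pos hz0, Real.rpow_def_of_pos hq0,
    ← Real.exp_sub, pow_zero, one_mul, htri]
  refine Real.exp_le_exp.2 ?_
  have h1 : Real.log ‖z‖ * n ≤ |Real.log ‖z‖| * |(n : ℝ)| := by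
    rw [← abs_mul]; exact le_abs_self _
  have h2 : Real.log q * n ≤ Real.log q * |(n : ℝ)| :=
    mul_le_mul_of_nonneg_left (le_abs_self _) hlog.le
  have h3 : -π * (Real.log q / (2 * π) * (n : ℝ) ^ 2 -
      2 * ((|Real.log ‖z‖| + Real.log q / 2) / (2 * π)) * ↑|n|) =
      -(Real.log q / 2 * (n : ℝ) ^ 2) + (|Real.log ‖z‖| + Real.log q / 2) * |(n : ℝ)| := by
    push_cast
    field_simp
    ring
  rw [h3]
  nlinarith

lemma jacobiThetaQ_mul {q : ℝ} (hq : q ≠ 0) {z : ℂ} (hz : z ≠ 0) :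
    jacobiThetaQ q (z * q) = z * q * jacobiThetaQ q z := by
  have hq' : (q : ℂ) ≠ 0 := by exact_mod_cast hq
  unfold jacobiThetaQ
  rw [← (Equiv.addRight (1 : ℤ)).tsum_eq, ← tsum_mul_left]
  refine tsum_congr fun n => ?_
  rw [Equiv.coe_addRight, thetaTerm_succ hq (mul_ne_zero hz hq'), mul_zpow]
  field_simp

/-- The finite Jacobi triple product. -/
lemma prod_mul_prod_eq_sum {q : ℝ} (hq : q ≠ 0) {z : ℂ} (hz : z ≠ 0) (N : ℕ) :
    (∏ k ∈ range N, (1 + z * ((q⁻¹ : ℝ) : ℂ) ^ k)) *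
        ∏ k ∈ range N, (1 + z⁻¹ * ((q⁻¹ : ℝ) : ℂ) ^ (k + 1)) =
      ∑ j ∈ range (2 * N + 1), (gaussBinom q⁻¹ (2 * N) j : ℂ) *
        (z ^ ((j : ℤ) - N) / (q : ℂ) ^ ((((j : ℤ) - N) * ((j : ℤ) - N - 1)) / 2)) := by
  have hq' : (q : ℂ) ≠ 0 := by exact_mod_cast hq
  have hE : ∏ k ∈ range N, (z * (q : ℂ) ^ (k + 1)) ≠ 0 :=
    prod_ne_zero_iff.2 fun k _ => mul_ne_zero hz (pow_ne_zero _ hq')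
  have hbase : ∀ M : ℕ, (∏ k ∈ range M, (z * (q : ℂ) ^ (k + 1))) *
      (z ^ (-(M : ℤ)) / (q : ℂ) ^ ((-(M : ℤ) * (-(M : ℤ) - 1)) / 2)) = 1 := by
    intro M
    induction M with
    | zero => simp
    | succ M ih =>
      have h := thetaTerm_succ hq hz (-((M + 1 : ℕ) : ℤ))
      rw [show -((M + 1 : ℕ) : ℤ) + 1 = -(M : ℤ) by push_cast; ring] at h
      rw [h] at ih
      rw [prod_range_succ, ← ih, zpow_neg _ ((M + 1 : ℕ) : ℤ), zpow_neg _ ((M + 1 : ℕ) : ℤ),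
        zpow_natCast, zpow_natCast]
      field_simp
  have hterm : ∀ j : ℕ, (∏ i ∈ range j, ((q⁻¹ : ℝ) : ℂ) ^ i) * (z * (q : ℂ) ^ N) ^ j =
      (∏ k ∈ range N, (z * (q : ℂ) ^ (k + 1))) *
        (z ^ ((j : ℤ) - N) / (q : ℂ) ^ ((((j : ℤ) - N) * ((j : ℤ) - N - 1)) / 2)) := by
    intro j
    induction j with
    | zero => simpa using (hbase N).symm
    | succ j ih =>
      have h := thetaTerm_succ hq hz ((j : ℤ) - N)
      rw [show ((j + 1 : ℕ) : ℤ) - N = (j : ℤ) - N + 1 by push_cast; ring, h, ← mul_assoc, ← ih,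
        prod_range_succ, pow_succ, zpow_sub₀ hq', zpow_natCast, zpow_natCast]
      simp only [ofReal_inv]
      generalize ∏ i ∈ range j, (q : ℂ)⁻¹ ^ i = P
      rw [inv_pow]
      field_simp
  have hprod : ∏ k ∈ range (2 * N), (1 + (z * (q : ℂ) ^ N) * ((q⁻¹ : ℝ) : ℂ) ^ k) =
      (∏ k ∈ range N, (z * (q : ℂ) ^ (k + 1))) *
      ((∏ k ∈ range N, (1 + z * ((q⁻¹ : ℝ) : ℂ) ^ k)) *
        ∏ k ∈ range N, (1 + z⁻¹ * ((q⁻¹ : ℝ) : ℂ) ^ (k + 1))) := by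
    rw [two_mul, prod_range_add, ← prod_range_reflect, mul_left_comm]
    refine (mul_comm _ _).trans (congrArg₂ (· * ·) ?_ ?_)
    · refine prod_congr rfl fun k _ => ?_
      simp only [ofReal_inv, inv_pow, pow_add]
      field_simp
    · rw [← prod_mul_distrib]
      refine prod_congr rfl fun k hk => ?_
      have hk' := mem_range.1 hk
      obtain ⟨d, rfl⟩ : ∃ d, N = d + (k + 1) := ⟨N - (k + 1), by omega⟩
      rw [show d + (k + 1) - 1 - k = d by omega]
      simp only [ofReal_inv, inv_pow, pow_add, pow_one]
      field_simp
      ring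
  refine mul_left_cancel₀ hE ?_
  rw [← hprod, prod_one_add_mul_pow, mul_sum]
  refine sum_congr rfl fun j _ => ?_
  rw [mul_assoc, hterm]
  ring

/-- The Jacobi triple product, as a limit of finite products. -/
lemma tendsto_prod_jacobiThetaQ {q L : ℝ} (hq : 1 < q) (hL : 0 < L)
    (hLe : ∀ n, L ≤ eulerProd q⁻¹ n) (hLt : Tendsto (eulerProd q⁻¹) atTop (𝓝 L))
    {z : ℂ} (hz : z ≠ 0) :
    Tendsto (fun N : ℕ => (∏ k ∈ range N, (1 + z * ((q⁻¹ : ℝ) : ℂ) ^ k)) *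
        ∏ k ∈ range N, (1 + z⁻¹ * ((q⁻¹ : ℝ) : ℂ) ^ (k + 1))) atTop
      (𝓝 (((L⁻¹ : ℝ) : ℂ) * jacobiThetaQ q z)) := by
  have hq0 : 0 < q := by linarith
  have hp0 : 0 < q⁻¹ := by positivity
  have hp1 : q⁻¹ < 1 := inv_lt_one_of_one_lt₀ hq
  set t : ℤ → ℂ := fun n => z ^ n / (q : ℂ) ^ ((n * (n - 1)) / 2)
  let c : ℕ → ℤ → ℝ := fun N n =>
    if 0 ≤ n + N then gaussBinom q⁻¹ (2 * N) (n + N).toNat else 0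
  have hc : ∀ N n, ‖c N n‖ ≤ 1 / L ^ 2 := by
    intro N n
    simp only [c]
    split_ifs
    · rw [Real.norm_of_nonneg (gaussBinom_nonneg hp0.le _ _)]
      exact gaussBinom_le hp0 hp1 hL hLe _ _
    · rw [norm_zero]; positivity
  have hlim : ∀ n, Tendsto (fun N => c N n) atTop (𝓝 L⁻¹) := by
    intro n
    have h2 : Tendsto (fun N : ℕ => 2 * N) atTop atTop :=
      tendsto_id.const_mul_atTop' two_pos
    have hsh : ∀ m : ℤ, Tendsto (fun N : ℕ => (m + N).toNat) atTop atTop := by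
      intro m
      refine tendsto_atTop.2 fun b => ?_
      filter_upwards [eventually_ge_atTop (b + m.natAbs)] with N hN
      omega
    have h := (hLt.comp h2).div ((hLt.comp (hsh n)).mul (hLt.comp (hsh (-n)))) (by positivity)
    rw [show L / (L * L) = L⁻¹ by field_simp] at h
    refine h.congr' ?_
    filter_upwards [eventually_ge_atTop n.natAbs] with N hN
    have hn : 0 ≤ n + N := by omega
    simp only [c, if_pos hn, Pi.div_apply, Function.comp_apply]
    rw [div_eq_iff (mul_pos (eulerProd_pos hp0 hp1 _) (eulerProd_pos hp0 hp1 _)).ne']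
    exact (gaussBinom_mul_eulerProd _ (by omega)).symm
  have hsum := tendsto_tsum_of_dominated_convergence (𝓕 := atTop)
    (f := fun N n => (c N n : ℂ) * t n) (g := fun n => ((L⁻¹ : ℝ) : ℂ) * t n)
    ((summable_norm_thetaTerm hq hz).mul_left (1 / L ^ 2))
    (fun n => ((Complex.continuous_ofReal.tendsto _).comp (hlim n)).mul_const _)
    (Eventually.of_forall fun N n => by
      rw [norm_mul, norm_real]
      exact mul_le_mul_of_nonneg_right (hc N n) (norm_nonneg _))
  rw [tsum_mul_left] at hsum
  refine hsum.congr fun N => ?_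
  rw [prod_mul_prod_eq_sum hq0.ne' hz]
  let e : ℕ ↪ ℤ := ⟨fun j => (j : ℤ) - N, fun a b h => by simpa using h⟩
  have he : ∀ j, e j = (j : ℤ) - N := fun _ => rfl
  rw [tsum_eq_sum (s := (range (2 * N + 1)).map e), sum_map]
  · refine sum_congr rfl fun j _ => ?_
    simp [c, he, t]
  · intro n hn
    have : c N n = 0 := by
      simp only [c]
      split_ifs with h
      · refine gaussBinom_eq_zero _ ?_
        by_contra! hlt
        refine hn (mem_map.2 ⟨(n + N).toNat, mem_range.2 (by omega), ?_⟩)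
        rw [he]
        omega
      · rfl
    simp [this]

lemma eulerProd_le_norm_prod {p : ℝ} (hp0 : 0 < p) (hp1 : p < 1) {w : ℂ} (hw : ‖w‖ ≤ 1) (n : ℕ) :
    eulerProd p n ≤ ‖∏ k ∈ range n, (1 + w * (p : ℂ) ^ (k + 1))‖ := by
  rw [norm_prod]
  refine prod_le_prod (fun k _ => sub_nonneg.2 (pow_le_one₀ hp0.le hp1.le)) fun k _ => ?_
  have h1 : ‖w * (p : ℂ) ^ (k + 1)‖ ≤ p ^ (k + 1) := by
    rw [norm_mul, norm_pow, norm_real, Real.norm_of_nonneg hp0.le]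
    exact mul_le_of_le_one_left (by positivity) hw
  have h2 := norm_sub_le_norm_add (1 : ℂ) (w * (p : ℂ) ^ (k + 1))
  rw [norm_one] at h2
  linarith

lemma le_norm_mul_norm_of_lt {p δ : ℝ} (hp0 : 0 < p) (hp1 : p < 1) (hδ : 0 < δ) {z : ℂ}
    (h0 : δ < ‖1 + z‖) (h1 : δ < ‖1 + z * p‖) :
    (1 - p) / 2 * δ ≤ ‖1 + z * p‖ * ‖1 + z‖ := by
  have h : 1 - p ≤ ‖1 + z * p‖ + ‖1 + z‖ := by
    have e : ((1 - p : ℝ) : ℂ) = (1 + z * p) - p * (1 + z) := by push_cast; ring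
    have h2 : ‖((1 - p : ℝ) : ℂ)‖ ≤ ‖1 + z * p‖ + ‖(p : ℂ) * (1 + z)‖ := by
      rw [e]; exact norm_sub_le _ _
    rw [norm_real, norm_mul, norm_real, Real.norm_of_nonneg hp0.le,
      Real.norm_of_nonneg (by linarith)] at h2
    nlinarith [norm_nonneg (1 + z)]
  rcases le_total ((1 - p) / 2) ‖1 + z‖ with h3 | h3
  · nlinarith
  · nlinarith

lemma norm_jacobiThetaQ_ge_of_annulus {q L δ : ℝ} (hq : 1 < q) (hL : 0 < L)
    (hLe : ∀ n, L ≤ eulerProd q⁻¹ n) (hLt : Tendsto (eulerProd q⁻¹) atTop (𝓝 L)) (hδ : 0 < δ)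
    {z : ℂ} (hz1 : 1 ≤ ‖z‖) (hzq : ‖z‖ ≤ q) (h0 : δ < ‖1 + z‖)
    (h1 : δ < ‖1 + z * ((q⁻¹ : ℝ) : ℂ)‖) :
    L ^ 3 * ((1 - q⁻¹) / 2) * δ ≤ ‖jacobiThetaQ q z‖ := by
  have hq0 : 0 < q := by linarith
  have hp0 : 0 < q⁻¹ := by positivity
  have hp1 : q⁻¹ < 1 := inv_lt_one_of_one_lt₀ hq
  have hz : z ≠ 0 := norm_pos_iff.1 (by linarith)
  have hlim := (tendsto_prod_jacobiThetaQ hq hL hLe hLt hz).norm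
  have hge : L * ((1 - q⁻¹) / 2 * δ) * L ≤ ‖((L⁻¹ : ℝ) : ℂ) * jacobiThetaQ q z‖ := by
    refine ge_of_tendsto hlim ?_
    filter_upwards [eventually_ge_atTop 2] with N hN
    obtain ⟨K, rfl⟩ : ∃ K, N = K + 2 := ⟨N - 2, by omega⟩
    have hA : L ≤ ‖∏ k ∈ range K, (1 + z * ((q⁻¹ : ℝ) : ℂ) ^ (k + 1 + 1))‖ := by
      have hw : ‖z * ((q⁻¹ : ℝ) : ℂ)‖ ≤ 1 := by
        rw [norm_mul, norm_real, Real.norm_of_nonneg hp0.le]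
        exact mul_inv_le_one_of_le₀ hzq hq0.le
      refine ((hLe K).trans (eulerProd_le_norm_prod hp0 hp1 hw K)).trans_eq ?_
      congr 1
      exact prod_congr rfl fun k _ => by ring
    have hB := (hLe (K + 2)).trans (eulerProd_le_norm_prod hp0 hp1
      (w := z⁻¹) (by rw [norm_inv]; exact inv_le_one_of_one_le₀ hz1) (K + 2))
    have hC := le_norm_mul_norm_of_lt hp0 hp1 hδ h0 h1
    rw [norm_mul, prod_range_succ', prod_range_succ', norm_mul, norm_mul, zero_add, pow_one,
      pow_zero, mul_one, mul_assoc ‖∏ k ∈ range K, (1 + z * ((q⁻¹ : ℝ) : ℂ) ^ (k + 1 + 1))‖]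
    have : 0 ≤ (1 - q⁻¹) / 2 * δ := mul_nonneg (by linarith) hδ.le
    gcongr ?_ * ?_ * ?_
  rw [norm_mul, norm_real, Real.norm_of_nonneg (by positivity), inv_mul_eq_div,
    le_div_iff₀ hL] at hge
  linarith

/-- The comparison function `exp(log² r / (2 log q)) r^{1/2}` obeys the functional equation of
`Θ_q`. -/
lemma exp_log_sq_mul_rpow_mul {q r : ℝ} (hq : 1 < q) (hr : 0 < r) :
    Real.exp ((Real.log (r * q)) ^ 2 / (2 * Real.log q)) * (r * q) ^ ((1 : ℝ) / 2) =
      r * q * (Real.exp ((Real.log r) ^ 2 / (2 * Real.log q)) * r ^ ((1 : ℝ) / 2)) := by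
  have hq0 : 0 < q := by linarith
  have hlog : Real.log q ≠ 0 := (Real.log_pos hq).ne'
  have hrq : r * q = Real.exp (Real.log r + Real.log q) := by
    rw [Real.exp_add, Real.exp_log hr, Real.exp_log hq0]
  rw [Real.rpow_def_of_pos (mul_pos hr hq0), Real.rpow_def_of_pos hr,
    Real.log_mul hr.ne' hq0.ne', hrq, ← Real.exp_add, ← Real.exp_add, ← Real.exp_add]
  congr 1
  field_simp
  ring

lemma exp_log_sq_mul_rpow_le {q r : ℝ} (hq : 1 < q) (hr1 : 1 ≤ r) (hrq : r ≤ q) :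
    Real.exp ((Real.log r) ^ 2 / (2 * Real.log q)) * r ^ ((1 : ℝ) / 2) ≤ q := by
  have hq0 : 0 < q := by linarith
  have hr0 : 0 < r := by linarith
  have hlog : 0 < Real.log q := Real.log_pos hq
  have h0 : 0 ≤ Real.log r := Real.log_nonneg hr1
  have h1 : Real.log r ≤ Real.log q := Real.log_le_log hr0 hrq
  rw [Real.rpow_def_of_pos hr0, ← Real.exp_add]
  refine (Real.exp_le_exp.2 ?_).trans_eq (Real.exp_log hq0)
  have h2 : (Real.log r) ^ 2 / (2 * Real.log q) ≤ Real.log q / 2 := by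
    rw [div_le_iff₀ (by positivity)]
    nlinarith
  linarith

/-- A lower bound of `|Θ_q|` by a multiple of the comparison function propagates along `q^ℤ`. -/
lemma norm_jacobiThetaQ_ge_mul_zpow {q c : ℝ} (hq : 1 < q) {w : ℂ} (hw : w ≠ 0)
    (h : c * (Real.exp ((Real.log ‖w‖) ^ 2 / (2 * Real.log q)) * ‖w‖ ^ ((1 : ℝ) / 2))
      ≤ ‖jacobiThetaQ q w‖) (k : ℤ) :
    c * (Real.exp ((Real.log ‖w * (q : ℂ) ^ k‖) ^ 2 / (2 * Real.log q)) *
      ‖w * (q : ℂ) ^ k‖ ^ ((1 : ℝ) / 2)) ≤ ‖jacobiThetaQ q (w * (q : ℂ) ^ k)‖ := by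
  have hq0 : 0 < q := by linarith
  have hq' : (q : ℂ) ≠ 0 := by exact_mod_cast hq0.ne'
  have step : ∀ v : ℂ, v ≠ 0 →
      (c * (Real.exp ((Real.log ‖v * q‖) ^ 2 / (2 * Real.log q)) * ‖v * q‖ ^ ((1 : ℝ) / 2))
        ≤ ‖jacobiThetaQ q (v * q)‖ ↔
      c * (Real.exp ((Real.log ‖v‖) ^ 2 / (2 * Real.log q)) * ‖v‖ ^ ((1 : ℝ) / 2))
        ≤ ‖jacobiThetaQ q v‖) := by
    intro v hv
    have hv0 : 0 < ‖v‖ := norm_pos_iff.2 hv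
    rw [jacobiThetaQ_mul hq0.ne' hv, norm_mul (v * q), norm_mul v, norm_real,
      Real.norm_of_nonneg hq0.le, exp_log_sq_mul_rpow_mul hq hv0, mul_left_comm]
    exact mul_le_mul_iff_right₀ (mul_pos hv0 hq0)
  induction k with
  | zero => simpa using h
  | succ k ih =>
    rw [zpow_add_one₀ hq', ← mul_assoc w]
    exact (step _ (mul_ne_zero hw (zpow_ne_zero _ hq'))).2 ih
  | pred k ih =>
    rw [← step _ (mul_ne_zero hw (zpow_ne_zero _ hq')), mul_assoc, ← zpow_add_one₀ hq',
      sub_add_cancel]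
    exact ih

theorem theta_lower_bound (q : ℝ) (hq : 1 < q) :
    ∃ Δ : ℝ, 0 < Δ ∧ ∀ δ : ℝ, 0 < δ → ∀ z : ℂ, z ≠ 0 →
      (∀ m : ℤ, δ < ‖1 + z * (q : ℂ) ^ m‖) →
      Δ * δ * Real.exp ((Real.log ‖z‖) ^ 2 / (2 * Real.log q)) * ‖z‖ ^ ((1 : ℝ) / 2)
        ≤ ‖jacobiThetaQ q z‖ := by
  have hq0 : 0 < q := by linarith
  have hq' : (q : ℂ) ≠ 0 := by exact_mod_cast hq0.ne'
  have hp1 : q⁻¹ < 1 := inv_lt_one_of_one_lt₀ hq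
  have hp : 0 < 1 - q⁻¹ := by linarith
  obtain ⟨L, hL, hLe, hLt⟩ := exists_tendsto_eulerProd (inv_pos.2 hq0) hp1
  refine ⟨L ^ 3 * ((1 - q⁻¹) / 2) / q, by positivity, fun δ hδ z hz hm => ?_⟩
  obtain ⟨k, hk1, hk2⟩ := exists_mem_Ico_zpow (norm_pos_iff.2 hz) hq
  obtain ⟨w, rfl⟩ : ∃ w : ℂ, z = w * (q : ℂ) ^ k :=
    ⟨z / (q : ℂ) ^ k, (div_mul_cancel₀ _ (zpow_ne_zero _ hq')).symm⟩
  have hw : w ≠ 0 := left_ne_zero_of_mul hz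
  have hqk : 0 < q ^ k := zpow_pos hq0 k
  rw [norm_mul, norm_zpow, norm_real, Real.norm_of_nonneg hq0.le] at hk1 hk2
  have hw1 : 1 ≤ ‖w‖ := (le_mul_iff_one_le_left hqk).1 hk1
  have hwq : ‖w‖ ≤ q := by
    rw [zpow_add_one₀ hq0.ne', mul_comm] at hk2
    exact (lt_of_mul_lt_mul_left hk2 hqk.le).le
  have hm' : ∀ m : ℤ, δ < ‖1 + w * (q : ℂ) ^ m‖ := fun m => by
    have := hm (m - k)
    rwa [mul_assoc, ← zpow_add₀ hq', add_sub_cancel] at this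
  have hann := norm_jacobiThetaQ_ge_of_annulus hq hL hLe hLt hδ hw1 hwq
    (by simpa using hm' 0) (by simpa using hm' (-1))
  rw [mul_assoc]
  refine norm_jacobiThetaQ_ge_mul_zpow hq hw (le_trans ?_ hann) k
  calc _ ≤ L ^ 3 * ((1 - q⁻¹) / 2) / q * δ * q :=
        mul_le_mul_of_nonneg_left (exp_log_sq_mul_rpow_le hq hw1 hwq) (by positivity)
    _ = L ^ 3 * ((1 - q⁻¹) / 2) * δ := by field_simp
end

section
/- Let q>1 be a real number, r>0, and let f be holomorphic on the disk D(0,r). Suppose K>0 and α∈ℝ are such that |E_q(ξ)| ≤ K · exp( (log|ξ|)² / (2 log q) ) · |ξ|^α for all ξ∈ℂ∖{0}. Then for every ε∈(0,r), every k∈ℕ and every z with 0 < |z| < q^{−k} ε · min{1, q^{1/2−α}}, the k-th iterate of the operator D̃_q applied to f satisfies D̃_q^k f(z) = (q / (2πi log q)) · ∫_0^{2π} f(ε e^{it}) · ( ∫_0^∞ (s e^{−it})^k · E_q(z s e^{−it}) / Θ_q(q ε s) · e^{−it} ds ) · i ε e^{it} dt; that is, D̃_q^k f(z) = (q / (2πi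 log q)) ∮_{|ω|=ε} f(ω) ∫_{L_{θ(ω)}} ζ^k E_q(zζ)/Θ_q(qωζ) dζ dω with the inner ray taken in direction θ(ω) = −arg(ω). -/
set_option autoImplicit false

open Complex Real MeasureTheory

/-- The q-analog of the exponential `E_q(z) = ∑_{n ≥ 0} q^{-n(n-1)/2} z^n`. -/
noncomputable def Eq' (q : ℝ) (z : ℂ) : ℂ :=
  ∑' n : ℕ, z ^ n / (q : ℂ) ^ (n * (n - 1) / 2)

/-- The operator `D̃_q f(z) = (f(qz) - f(0))/(qz)`, extended holomorphically to `z = 0`. -/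
noncomputable def Dtilde (q : ℝ) (f : ℂ → ℂ) : ℂ → ℂ := fun z =>
  if z = 0 then deriv f 0 else (f (q * z) - f 0) / (q * z)

/-- The real Theta series, through `ℝ≥0∞` so that measurability is immediate. -/
noncomputable def realThetaQ (q s : ℝ) : ℝ :=
  (∑' n : ℤ, ENNReal.ofReal (s ^ n / q ^ ((n * (n - 1)) / 2))).toReal

lemma measurable_realThetaQ (q : ℝ) : Measurable (realThetaQ q) := by
  unfold realThetaQ
  refine (Measurable.tsum fun n => ?_).ennreal_toReal
  exact ENNReal.measurable_ofReal.comp ((measurable_id.pow_const n).div_const _)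

lemma realThetaQ_eq_tsum {q s : ℝ} (hq : 0 < q) (hs : 0 < s) :
    realThetaQ q s = ∑' n : ℤ, s ^ n / q ^ ((n * (n - 1)) / 2) := by
  unfold realThetaQ
  rw [ENNReal.tsum_toReal_eq fun _ => ENNReal.ofReal_ne_top]
  exact tsum_congr fun n => ENNReal.toReal_ofReal (by positivity)

lemma jacobiThetaQ_ofReal {q s : ℝ} (hq : 0 < q) (hs : 0 < s) :
    jacobiThetaQ q (s : ℂ) = (realThetaQ q s : ℂ) := by
  rw [realThetaQ_eq_tsum hq hs, jacobiThetaQ, Complex.ofReal_tsum]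
  exact tsum_congr fun n => by push_cast; rfl

lemma triangular_add (m n : ℤ) :
    ((m + n) * (m + n - 1)) / 2 = (m * (m - 1)) / 2 + (n * (n - 1)) / 2 + m * n := by
  have h := Int.even_mul_pred_self m
  have h' := Int.even_mul_pred_self n
  obtain ⟨a, ha⟩ := h
  obtain ⟨b, hb⟩ := h'
  have : (m + n) * (m + n - 1) = 2 * (a + b + m * n) := by linear_combination ha + hb
  rw [this, ha, hb]
  omega

lemma triangular_nat_succ (n : ℕ) : (n + 1) * (n + 1 - 1) / 2 = n * (n - 1) / 2 + n := by
  rw [← Finset.sum_range_id_mul_two, ← Finset.sum_range_id_mul_two]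
  simp [Finset.sum_range_succ]

lemma summable_pow_div_triangular {q : ℝ} (hq : 1 < q) (x : ℝ) :
    Summable fun n : ℕ => x ^ n / q ^ (n * (n - 1) / 2) := by
  have hq0 : 0 < q := by linarith
  rcases eq_or_ne x 0 with rfl | hx
  · refine summable_of_ne_finset_zero (s := {0}) fun n hn => ?_
    simp at hn
    simp [hn]
  refine summable_of_ratio_test_tendsto_lt_one (l := 0) one_pos
    (Filter.Eventually.of_forall fun n => by positivity) ?_
  have h : Filter.Tendsto (fun n : ℕ => |x| * (q⁻¹) ^ n) Filter.atTop (nhds (|x| * 0)) :=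
    (tendsto_pow_atTop_nhds_zero_of_lt_one (by positivity) (inv_lt_one_of_one_lt₀ hq)).const_mul _
  rw [mul_zero] at h
  refine h.congr fun n => ?_
  rw [triangular_nat_succ, norm_div, norm_div, norm_pow, norm_pow, norm_pow, norm_pow,
    Real.norm_of_nonneg hq0.le, Real.norm_eq_abs]
  have : |x| ≠ 0 := by simpa using hx
  field_simp
  rw [one_div, inv_pow, pow_add, pow_succ]
  field_simp

lemma triangular_cast (n : ℕ) : ((n : ℤ) * (n - 1)) / 2 = ((n * (n - 1) / 2 : ℕ) : ℤ) := by
  cases n with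
  | zero => simp
  | succ n => push_cast; simp

lemma summable_realThetaQ {q s : ℝ} (hq : 1 < q) (hs : 0 < s) :
    Summable fun n : ℤ => s ^ n / q ^ ((n * (n - 1)) / 2) := by
  have hq0 : 0 < q := by linarith
  refine Summable.of_nat_of_neg ?_ ?_
  · refine (summable_pow_div_triangular hq s).congr fun n => ?_
    rw [triangular_cast, zpow_natCast, zpow_natCast]
  · refine (summable_pow_div_triangular hq (s * q)⁻¹).congr fun n => ?_
    have h : (-(n : ℤ) * (-(n : ℤ) - 1)) / 2 = ((n * (n - 1) / 2 : ℕ) : ℤ) + n := by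
      rw [← triangular_cast, show -(n : ℤ) * (-(n : ℤ) - 1) = n * (n - 1) + n * 2 by ring,
        Int.add_mul_ediv_right _ _ (by norm_num)]
    rw [h, zpow_add₀ hq0.ne', zpow_natCast, zpow_neg, zpow_natCast, zpow_natCast, inv_pow, mul_pow]
    field_simp

lemma realThetaQ_pos {q s : ℝ} (hq : 1 < q) (hs : 0 < s) : 0 < realThetaQ q s := by
  have hq0 : 0 < q := by linarith
  rw [realThetaQ_eq_tsum hq0 hs]
  exact (summable_realThetaQ hq hs).tsum_pos (fun n => by positivity) 0 (by positivity)

/-- Quasi-periodicity of the Theta function under `s ↦ q ^ n * s`. -/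
lemma realThetaQ_zpow_mul {q s : ℝ} (hq : 1 < q) (hs : 0 < s) (n : ℤ) :
    realThetaQ q (q ^ n * s) = q ^ ((-n * (-n - 1)) / 2) * s ^ n * realThetaQ q s := by
  have hq0 : 0 < q := by linarith
  rw [realThetaQ_eq_tsum hq0 (by positivity), realThetaQ_eq_tsum hq0 hs,
    ← (Equiv.subRight n).tsum_eq (fun m : ℤ => s ^ m / q ^ ((m * (m - 1)) / 2)), ← tsum_mul_left]
  refine tsum_congr fun m => ?_
  simp only [Equiv.subRight_apply]
  rw [sub_eq_add_neg m n, triangular_add m (-n), zpow_add₀ hs.ne', zpow_add₀ hq0.ne',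
    zpow_add₀ hq0.ne', mul_zpow, ← zpow_mul, zpow_neg, mul_neg, zpow_neg, mul_comm n m]
  field_simp

lemma realThetaQ_mul {q s : ℝ} (hq : 1 < q) (hs : 0 < s) :
    realThetaQ q (q * s) = q * s * realThetaQ q s := by
  simpa using realThetaQ_zpow_mul hq hs 1

lemma tsum_inv_realThetaQ {q s : ℝ} (hq : 1 < q) (hs : 0 < s) :
    ∑' n : ℤ, ENNReal.ofReal (realThetaQ q (q ^ n * s))⁻¹ = 1 := by
  have hq0 : 0 < q := by linarith
  have hT := realThetaQ_pos hq hs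
  have h : ∀ n : ℤ, (realThetaQ q (q ^ n * s))⁻¹
      = (s ^ (-n) / q ^ ((-n * (-n - 1)) / 2)) * (realThetaQ q s)⁻¹ := fun n => by
    rw [realThetaQ_zpow_mul hq hs, zpow_neg]
    field_simp
  simp_rw [h]
  have h' := (Equiv.neg ℤ).tsum_eq fun n : ℤ =>
    ENNReal.ofReal (s ^ n / q ^ ((n * (n - 1)) / 2) * (realThetaQ q s)⁻¹)
  simp only [Equiv.neg_apply] at h'
  rw [h', ← ENNReal.ofReal_tsum_of_nonneg (fun n => by positivity)
      ((summable_realThetaQ hq hs).mul_right _), tsum_mul_right, ← realThetaQ_eq_tsum hq0 hs,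
    mul_inv_cancel₀ hT.ne', ENNReal.ofReal_one]

lemma lintegral_eq_lintegral_tsum_translates {G : ℝ → ENNReal} (hG : Measurable G) :
    ∫⁻ x, G x = ∫⁻ x in Set.Ioc (0 : ℝ) 1, ∑' n : ℤ, G (x + n) := by
  rw [← setLIntegral_univ, ← iUnion_Ioc_intCast ℝ,
    lintegral_iUnion (fun _ => measurableSet_Ioc) (Set.pairwise_disjoint_Ioc_intCast ℝ),
    lintegral_tsum (f := fun (n : ℤ) x => G (x + n))
      fun n => (hG.comp (measurable_add_const _)).aemeasurable]
  refine tsum_congr fun n => ?_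
  rw [← (measurePreserving_add_right volume (n : ℝ)).setLIntegral_comp_preimage
    measurableSet_Ioc hG]
  simp

lemma lintegral_inv_mul_realThetaQ {q : ℝ} (hq : 1 < q) :
    ∫⁻ s in Set.Ioi (0 : ℝ), ENNReal.ofReal (s * realThetaQ q s)⁻¹
      = ENNReal.ofReal (Real.log q) := by
  have hq0 : 0 < q := by linarith
  have hl : 0 < Real.log q := Real.log_pos hq
  have himg : (fun x : ℝ => q ^ x) '' Set.univ = Set.Ioi 0 := by
    ext y
    simp only [Set.image_univ, Set.mem_range, Set.mem_Ioi]
    refine ⟨fun ⟨x, hx⟩ => hx ▸ Real.rpow_pos_of_pos hq0 x,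
      fun hy => ⟨Real.logb q y, Real.rpow_logb hq0 hq.ne' hy⟩⟩
  have hmeas : Measurable fun x : ℝ => ENNReal.ofReal (realThetaQ q (q ^ x))⁻¹ :=
    ENNReal.measurable_ofReal.comp
      ((measurable_realThetaQ q).comp (measurable_id.const_pow q)).inv
  rw [← himg, lintegral_image_eq_lintegral_abs_deriv_mul MeasurableSet.univ
    (fun x _ => (Real.hasStrictDerivAt_const_rpow hq0 x).hasDerivAt.hasDerivWithinAt)
    ((Real.strictMono_rpow_of_base_gt_one hq).injective.injOn), setLIntegral_univ]
  have h : ∀ x : ℝ, ENNReal.ofReal |q ^ x * Real.log q| *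
      ENNReal.ofReal (q ^ x * realThetaQ q (q ^ x))⁻¹
      = ENNReal.ofReal (Real.log q) * ENNReal.ofReal (realThetaQ q (q ^ x))⁻¹ := fun x => by
    have hx := Real.rpow_pos_of_pos hq0 x
    rw [abs_of_pos (by positivity), ← ENNReal.ofReal_mul (by positivity),
      ← ENNReal.ofReal_mul hl.le, mul_inv]
    congr 1
    field_simp
  simp_rw [h]
  rw [lintegral_const_mul _ hmeas, lintegral_eq_lintegral_tsum_translates hmeas]
  have h1 : ∀ x : ℝ, ∑' n : ℤ, ENNReal.ofReal (realThetaQ q (q ^ (x + n)))⁻¹ = 1 := fun x => by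
    rw [← tsum_inv_realThetaQ hq (Real.rpow_pos_of_pos hq0 x)]
    refine tsum_congr fun n => ?_
    rw [Real.rpow_add hq0, Real.rpow_intCast, mul_comm]
  simp [h1]

lemma moment_realThetaQ {q : ℝ} (hq : 1 < q) (n : ℕ) :
    IntegrableOn (fun s : ℝ => s ^ n * (s * realThetaQ q s)⁻¹) (Set.Ioi 0) ∧
      ∫ s in Set.Ioi (0 : ℝ), s ^ n * (s * realThetaQ q s)⁻¹
        = q ^ (n * (n - 1) / 2) * Real.log q := by
  have hq0 : 0 < q := by linarith
  have hl : 0 < Real.log q := Real.log_pos hq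
  induction n with
  | zero =>
    have hm : Measurable fun s : ℝ => (s * realThetaQ q s)⁻¹ :=
      (measurable_id.mul (measurable_realThetaQ q)).inv
    have hnn : 0 ≤ᵐ[volume.restrict (Set.Ioi (0 : ℝ))] fun s : ℝ => (s * realThetaQ q s)⁻¹ := by
      filter_upwards [ae_restrict_mem measurableSet_Ioi] with s hs
      have := realThetaQ_pos hq hs
      have : (0 : ℝ) < s := hs
      simp only [Pi.zero_apply]
      positivity
    simp only [pow_zero, one_mul, zero_mul, Nat.zero_div]
    refine ⟨⟨hm.aestronglyMeasurable, ?_⟩, ?_⟩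
    · rw [hasFiniteIntegral_iff_ofReal hnn, lintegral_inv_mul_realThetaQ hq]
      exact ENNReal.ofReal_lt_top
    · rw [integral_eq_lintegral_of_nonneg_ae hnn hm.aestronglyMeasurable,
        lintegral_inv_mul_realThetaQ hq, ENNReal.toReal_ofReal hl.le]
  | succ n ih =>
    have key : Set.EqOn (fun s : ℝ => (q * s) ^ (n + 1) * (q * s * realThetaQ q (q * s))⁻¹)
        (fun s : ℝ => q ^ n * q⁻¹ * (s ^ n * (s * realThetaQ q s)⁻¹)) (Set.Ioi 0) := by
      intro s hs
      have h1 := realThetaQ_pos hq hs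
      have h2 : (0 : ℝ) < s := hs
      simp only
      rw [realThetaQ_mul hq hs, mul_pow, pow_succ, pow_succ]
      field_simp
    have hi := integrableOn_Ioi_comp_mul_left_iff
      (fun s : ℝ => s ^ (n + 1) * (s * realThetaQ q s)⁻¹) 0 hq0
    have he := integral_comp_mul_left_Ioi
      (fun s : ℝ => s ^ (n + 1) * (s * realThetaQ q s)⁻¹) 0 hq0
    rw [mul_zero] at hi he
    refine ⟨hi.1 ((integrableOn_congr_fun key measurableSet_Ioi).2 (ih.1.const_mul _)), ?_⟩
    rw [setIntegral_congr_fun measurableSet_Ioi key, integral_const_mul, ih.2, smul_eq_mul] at he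
    rw [triangular_nat_succ, pow_add]
    field_simp at he ⊢
    linarith

lemma moment_realThetaQ_mul {q ε : ℝ} (hq : 1 < q) (hε : 0 < ε) (n : ℕ) :
    IntegrableOn (fun s : ℝ => s ^ n / realThetaQ q (q * ε * s)) (Set.Ioi 0) ∧
      ∫ s in Set.Ioi (0 : ℝ), s ^ n / realThetaQ q (q * ε * s)
        = q ^ (n * (n - 1) / 2) * Real.log q / (q * ε ^ (n + 1)) := by
  have hq0 : 0 < q := by linarith
  obtain ⟨h1, h2⟩ := moment_realThetaQ hq n
  have key : Set.EqOn (fun s : ℝ => s ^ n / realThetaQ q (q * ε * s))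
      (fun s : ℝ => (q * ε ^ n)⁻¹ * ((ε * s) ^ n * (ε * s * realThetaQ q (ε * s))⁻¹))
      (Set.Ioi 0) := by
    intro s hs
    have h2 : (0 : ℝ) < s := hs
    have h1 := realThetaQ_pos hq (mul_pos hε h2)
    simp only
    rw [mul_assoc q, realThetaQ_mul hq (by positivity), mul_pow]
    field_simp
  have hi := integrableOn_Ioi_comp_mul_left_iff
    (fun s : ℝ => s ^ n * (s * realThetaQ q s)⁻¹) 0 hε
  have he := integral_comp_mul_left_Ioi (fun s : ℝ => s ^ n * (s * realThetaQ q s)⁻¹) 0 hε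
  rw [mul_zero] at hi he
  refine ⟨(integrableOn_congr_fun key measurableSet_Ioi).2 ((hi.2 h1).const_mul _), ?_⟩
  rw [setIntegral_congr_fun measurableSet_Ioi key, integral_const_mul, he, h2, smul_eq_mul, pow_succ]
  field_simp

lemma hasSum_Dtilde {q R : ℝ} (hq : 1 < q) (hR : 0 < R) {g : ℂ → ℂ} {a : ℕ → ℂ}
    (h : ∀ z : ℂ, ‖z‖ < R → HasSum (fun n => a n * z ^ n) (g z)) (z : ℂ) (hz : ‖z‖ < R / q) :
    HasSum (fun n => (q : ℂ) ^ n * a (n + 1) * z ^ n) (Dtilde q g z) := by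
  have hq0 : 0 < q := by linarith
  have hqC : (q : ℂ) ≠ 0 := by exact_mod_cast hq0.ne'
  have h0 : g 0 = a 0 := by
    refine (h 0 (by simpa using hR)).unique ?_
    simpa using hasSum_single (f := fun n => a n * (0 : ℂ) ^ n) 0 fun n hn => by simp [hn]
  unfold Dtilde
  split_ifs with hz0
  · subst hz0
    have hp : HasFPowerSeriesAt g (FormalMultilinearSeries.ofScalars ℂ a) 0 := by
      rw [hasFPowerSeriesAt_iff]
      filter_upwards [Metric.ball_mem_nhds (0 : ℂ) hR] with y hy
      simpa [FormalMultilinearSeries.coeff_ofScalars, mul_comm] using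
        h y (by simpa using hy)
    rw [hp.deriv]
    simpa [FormalMultilinearSeries.ofScalars_apply_eq] using
      hasSum_single (f := fun n => (q : ℂ) ^ n * a (n + 1) * (0 : ℂ) ^ n) 0
        fun n hn => by simp [hn]
  · have hqz : ‖(q : ℂ) * z‖ < R := by
      rw [norm_mul, Complex.norm_real, Real.norm_of_nonneg hq0.le, mul_comm]
      exact (lt_div_iff₀ hq0).1 hz
    have h1 := (hasSum_nat_add_iff' 1).2 (h _ hqz)
    simp only [Finset.sum_range_one, pow_zero, mul_one] at h1
    rw [h0]
    refine (h1.div_const ((q : ℂ) * z)).congr_fun fun n => ?_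
    rw [pow_succ, mul_pow]
    field_simp

lemma hasSum_Dtilde_iterate {q R : ℝ} (hq : 1 < q) (hR : 0 < R) {g : ℂ → ℂ} {a : ℕ → ℂ}
    (h : ∀ z : ℂ, ‖z‖ < R → HasSum (fun n => a n * z ^ n) (g z)) (k : ℕ) (z : ℂ)
    (hz : ‖z‖ < R / q ^ k) :
    HasSum (fun n => (q : ℂ) ^ ((n + k) * (n + k - 1) / 2) / (q : ℂ) ^ (n * (n - 1) / 2)
      * a (n + k) * z ^ n) ((Dtilde q)^[k] g z) := by
  have hq0 : 0 < q := by linarith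
  have hqC : (q : ℂ) ≠ 0 := by exact_mod_cast hq0.ne'
  induction k generalizing z with
  | zero =>
    refine (h z (by simpa using hz)).congr_fun fun n => ?_
    simp [hqC]
  | succ k ih =>
    rw [Function.iterate_succ_apply']
    refine (hasSum_Dtilde hq (by positivity) ih z (by rwa [div_div, ← pow_succ])).congr_fun
      fun n => ?_
    rw [triangular_nat_succ n, pow_add, add_right_comm n 1 k, add_assoc n k 1]
    field_simp

lemma hasSum_integral_Eq_div_jacobiThetaQ {q ε : ℝ} (hq : 1 < q) (hε : 0 < ε) (k : ℕ) {z e : ℂ}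
    (he : ‖e‖ = 1) (hsum : Summable fun n : ℕ => ‖z ^ n / (q : ℂ) ^ (n * (n - 1) / 2)‖ *
      (q ^ ((n + k) * (n + k - 1) / 2) * Real.log q / (q * ε ^ (n + k + 1)))) :
    HasSum (fun n : ℕ => e ^ (n + k + 1) * (z ^ n / (q : ℂ) ^ (n * (n - 1) / 2) *
        ((q ^ ((n + k) * (n + k - 1) / 2) * Real.log q / (q * ε ^ (n + k + 1)) : ℝ) : ℂ)))
      (∫ s in Set.Ioi (0 : ℝ), ((s : ℂ) * e) ^ k * Eq' q (z * s * e) /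
        jacobiThetaQ q (q * ε * s) * e) := by
  have hq0 : 0 < q := by linarith
  have hqC : (q : ℂ) ≠ 0 := by exact_mod_cast hq0.ne'
  set F : ℕ → ℝ → ℂ := fun n s => e ^ (n + k + 1) * (z ^ n / (q : ℂ) ^ (n * (n - 1) / 2)) *
    ((s ^ (n + k) / realThetaQ q (q * ε * s) : ℝ) : ℂ) with hF
  have hI : ∀ n, Integrable (F n) (volume.restrict (Set.Ioi 0)) := fun n =>
    ((moment_realThetaQ_mul hq hε (n + k)).1.ofReal (𝕜 := ℂ)).const_mul _
  have hN : ∀ n, ∫ s in Set.Ioi (0 : ℝ), ‖F n s‖ = ‖z ^ n / (q : ℂ) ^ (n * (n - 1) / 2)‖ *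
      (q ^ ((n + k) * (n + k - 1) / 2) * Real.log q / (q * ε ^ (n + k + 1))) := fun n => by
    rw [← (moment_realThetaQ_mul hq hε (n + k)).2, ← integral_const_mul]
    refine setIntegral_congr_fun measurableSet_Ioi fun s hs => ?_
    have hs0 : (0 : ℝ) < s := hs
    have := realThetaQ_pos hq (s := q * ε * s) (by positivity)
    simp only [hF]
    rw [norm_mul, norm_mul, norm_pow, he, one_pow, one_mul, Complex.norm_real,
      Real.norm_of_nonneg (by positivity)]
  have hS := hasSum_integral_of_summable_integral_norm hI (by simpa only [hN] using hsum)
  have hval : ∀ n, ∫ s in Set.Ioi (0 : ℝ), F n s =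
      e ^ (n + k + 1) * (z ^ n / (q : ℂ) ^ (n * (n - 1) / 2) *
        ((q ^ ((n + k) * (n + k - 1) / 2) * Real.log q / (q * ε ^ (n + k + 1)) : ℝ) : ℂ)) :=
    fun n => by
      rw [← (moment_realThetaQ_mul hq hε (n + k)).2]
      simp only [hF]
      rw [integral_const_mul, integral_complex_ofReal, mul_assoc]
  simp only [hval] at hS
  suffices hfun : Set.EqOn (fun s : ℝ => ((s : ℂ) * e) ^ k * Eq' q (z * s * e) /
      jacobiThetaQ q (q * ε * s) * e) (fun s => ∑' n, F n s) (Set.Ioi 0) by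
    rwa [setIntegral_congr_fun measurableSet_Ioi hfun]
  intro s hs
  have hs0 : (0 : ℝ) < s := hs
  simp only [hF]
  have hT : jacobiThetaQ q (q * ε * s) = (realThetaQ q (q * ε * s) : ℂ) := by
    rw [← jacobiThetaQ_ofReal hq0 (by positivity)]
    push_cast
    rfl
  rw [hT, Eq', ← tsum_mul_left, ← tsum_div_const, ← tsum_mul_right]
  refine tsum_congr fun n => ?_
  push_cast
  ring

lemma summable_moment_coeff {q ε : ℝ} (hq : 1 < q) (hε : 0 < ε) (k : ℕ) {z : ℂ}
    (hz : ‖z‖ < ε / q ^ k) : Summable fun n : ℕ => ‖z ^ n / (q : ℂ) ^ (n * (n - 1) / 2)‖ *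
      (q ^ ((n + k) * (n + k - 1) / 2) * Real.log q / (q * ε ^ (n + k + 1))) := by
  have hq0 : 0 < q := by linarith
  have hlt : ‖z‖ * q ^ k / ε < 1 := by
    rw [div_lt_one hε]
    exact (lt_div_iff₀ (by positivity)).1 hz
  refine ((summable_geometric_of_lt_one (by positivity) hlt).mul_left
    (q ^ (k * (k - 1) / 2) * Real.log q / (q * ε ^ (k + 1)))).congr fun n => ?_
  have hp : (n + k) * (n + k - 1) / 2 = n * (n - 1) / 2 + k * (k - 1) / 2 + n * k := by
    have := triangular_add n k
    rw [triangular_cast, triangular_cast, ← Nat.cast_add, triangular_cast] at this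
    exact_mod_cast this
  rw [hp, norm_div, norm_pow, norm_pow, Complex.norm_real, Real.norm_of_nonneg hq0.le,
    pow_add, pow_add, div_pow, mul_pow, ← pow_mul, mul_comm n k, add_assoc n k 1, pow_add ε n, pow_succ ε k]
  field_simp
  ring

lemma hasSum_cauchy_coeff {f : ℂ → ℂ} {r ε : ℝ} (hf : DifferentiableOn ℂ f (Metric.ball 0 r))
    (hε0 : 0 < ε) (hεr : ε < r) (z : ℂ) (hz : ‖z‖ < ε) :
    HasSum (fun n : ℕ => ((2 * π * Complex.I : ℂ)⁻¹ * ((ε : ℂ) ^ (n + 1))⁻¹ *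
      ∫ t in (0 : ℝ)..(2 * π), f (ε * Complex.exp (Complex.I * t)) *
        Complex.exp (-Complex.I * t) ^ (n + 1) *
        (Complex.I * ε * Complex.exp (Complex.I * t))) * z ^ n) (f z) := by
  lift ε to NNReal using hε0.le
  have hε0' : (0 : NNReal) < ε := by exact_mod_cast hε0
  have hd := (hf.mono (Metric.closedBall_subset_ball hεr)).hasFPowerSeriesOnBall hε0'
  have hs := hd.hasSum (y := z) (by simpa [← NNReal.coe_lt_coe] using hz)
  rw [zero_add] at hs
  refine hs.congr_fun fun n => ?_
  rw [FormalMultilinearSeries.apply_eq_pow_smul_coeff, FormalMultilinearSeries.coeff, smul_eq_mul,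
    mul_comm]
  congr 1
  refine Eq.trans ?_ (cauchyPowerSeries_apply f 0 ε n 1).symm
  rw [smul_eq_mul, mul_assoc, circleIntegral, ← intervalIntegral.integral_const_mul]
  congr 1
  refine intervalIntegral.integral_congr fun t _ => ?_
  have hεC : ((ε : ℝ) : ℂ) ≠ 0 := by exact_mod_cast hε0.ne'
  have hE := Complex.exp_ne_zero (t * Complex.I)
  simp only [deriv_circleMap, circleMap, zero_add, sub_zero, smul_eq_mul, one_div]
  rw [show -Complex.I * (t : ℂ) = -(t * Complex.I) by ring, Complex.exp_neg,
    mul_comm Complex.I (t : ℂ), inv_pow, inv_pow, mul_pow, pow_succ, pow_succ]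
  field_simp

theorem Dtilde_integral_representation (q : ℝ) (hq : 1 < q) (r : ℝ) (hr : 0 < r)
    (f : ℂ → ℂ) (hf : DifferentiableOn ℂ f (Metric.ball 0 r))
    (K α : ℝ) (hK : 0 < K)
    (hbound : ∀ ξ : ℂ, ξ ≠ 0 →
      ‖Eq' q ξ‖ ≤ K * Real.exp ((Real.log ‖ξ‖) ^ 2 / (2 * Real.log q)) * ‖ξ‖ ^ α)
    (ε : ℝ) (hε0 : 0 < ε) (hεr : ε < r) (k : ℕ) (z : ℂ) (hz : z ≠ 0)
    (hz2 : ‖z‖ < ε / q ^ k * min 1 ((q : ℝ) ^ ((1 : ℝ) / 2 - α))) :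
    (Dtilde q)^[k] f z = ((q : ℂ) / (2 * π * Complex.I * Real.log q)) *
      ∫ t in (0 : ℝ)..(2 * π),
        f (ε * Complex.exp (Complex.I * t)) *
          (∫ s in Set.Ioi (0 : ℝ),
            ((s : ℂ) * Complex.exp (-Complex.I * t)) ^ k *
              Eq' q (z * s * Complex.exp (-Complex.I * t)) /
              jacobiThetaQ q (q * ε * s) * Complex.exp (-Complex.I * t)) *
          (Complex.I * ε * Complex.exp (Complex.I * t)) := by
  have hq0 : 0 < q := by linarith
  have hl : 0 < Real.log q := Real.log_pos hq
  have hz' : ‖z‖ < ε / q ^ k :=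
    hz2.trans_le (mul_le_of_le_one_right (by positivity) (min_le_left _ _))
  have hD := hasSum_Dtilde_iterate hq hε0 (hasSum_cauchy_coeff hf hε0 hεr) k z hz'
  have hsum := summable_moment_coeff hq hε0 k hz'
  have hω : ∀ t : ℝ, ‖Complex.exp (Complex.I * t)‖ = 1 := fun t => by
    rw [mul_comm, Complex.norm_exp_ofReal_mul_I]
  have he : ∀ t : ℝ, ‖Complex.exp (-Complex.I * t)‖ = 1 := fun t => by
    simpa using hω (-t)
  have hfc : Continuous fun t : ℝ => f (ε * Complex.exp (Complex.I * t)) := by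
    refine hf.continuousOn.comp_continuous (by fun_prop) fun t => ?_
    rw [mem_ball_zero_iff, norm_mul, hω, Complex.norm_real, Real.norm_of_nonneg hε0.le, mul_one]
    exact hεr
  have hO := intervalIntegral.hasSum_integral_of_dominated_convergence (μ := volume)
    (a := 0) (b := 2 * π)
    (F := fun (n : ℕ) (t : ℝ) => f (ε * Complex.exp (Complex.I * t)) *
      (Complex.exp (-Complex.I * t) ^ (n + k + 1) * (z ^ n / (q : ℂ) ^ (n * (n - 1) / 2) *
        ((q ^ ((n + k) * (n + k - 1) / 2) * Real.log q / (q * ε ^ (n + k + 1)) : ℝ) : ℂ))) *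
      (Complex.I * ε * Complex.exp (Complex.I * t)))
    (fun n t => ‖f (ε * Complex.exp (Complex.I * t))‖ *
      (‖z ^ n / (q : ℂ) ^ (n * (n - 1) / 2)‖ *
        (q ^ ((n + k) * (n + k - 1) / 2) * Real.log q / (q * ε ^ (n + k + 1)))) * ε)
    (fun n => ((hfc.mul (by fun_prop)).mul (by fun_prop)).aestronglyMeasurable)
    (fun n => Filter.Eventually.of_forall fun t _ => le_of_eq (by
      rw [norm_mul, norm_mul, norm_mul, norm_pow, he, one_pow, one_mul, norm_mul, norm_mul,
        norm_mul, hω, Complex.norm_I, Complex.norm_real, Complex.norm_real,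
        Real.norm_of_nonneg hε0.le, one_mul, mul_one, Real.norm_of_nonneg (by positivity)]))
    (Filter.Eventually.of_forall fun t _ => (hsum.mul_left _).mul_right _)
    (by
      simp_rw [tsum_mul_right, tsum_mul_left]
      exact ((hfc.norm.mul continuous_const).mul continuous_const).intervalIntegrable _ _)
    (Filter.Eventually.of_forall fun t _ =>
      ((hasSum_integral_Eq_div_jacobiThetaQ hq hε0 k (he t) hsum).mul_left _).mul_right _)
  refine hD.unique ((hO.mul_left _).congr_fun fun n => ?_)
  have hqC : (q : ℂ) ≠ 0 := by exact_mod_cast hq0.ne'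
  have hlC : (Real.log q : ℂ) ≠ 0 := by exact_mod_cast hl.ne'
  have hεC : (ε : ℂ) ≠ 0 := by exact_mod_cast hε0.ne'
  have hpi : (π : ℂ) ≠ 0 := by exact_mod_cast Real.pi_ne_zero
  rw [show (fun t : ℝ => f (ε * Complex.exp (Complex.I * t)) *
      (Complex.exp (-Complex.I * t) ^ (n + k + 1) * (z ^ n / (q : ℂ) ^ (n * (n - 1) / 2) *
        ((q ^ ((n + k) * (n + k - 1) / 2) * Real.log q / (q * ε ^ (n + k + 1)) : ℝ) : ℂ))) *
      (Complex.I * ε * Complex.exp (Complex.I * t))) = fun t : ℝ =>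
      (z ^ n / (q : ℂ) ^ (n * (n - 1) / 2) *
        ((q ^ ((n + k) * (n + k - 1) / 2) * Real.log q / (q * ε ^ (n + k + 1)) : ℝ) : ℂ)) *
      (f (ε * Complex.exp (Complex.I * t)) * Complex.exp (-Complex.I * t) ^ (n + k + 1) *
        (Complex.I * ε * Complex.exp (Complex.I * t))) from funext fun t => by ring,
    intervalIntegral.integral_const_mul]
  push_cast
  field_simp
end
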